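/- Fix probability vectors p = (p_w, p_d, p_ℓ) and q = (q_w, q_d, q_ℓ) with q_w = q_ℓ > 0 and p_w < p_ℓ. For every policy π (a choice of style as a function of the round index and current score), the gain over n games satisfies limsup_{n → ∞} g_n^π ≤ 0. -/

import Mathlib

noncomputable section

open Filter Topology Finset

/-- The sign of an integer score, as a real number (`sgn 0 = 0`). -/
def sgn (x : ℤ) : ℝ := if 0 < x then 1 else if x < 0 then -1 else 0

/-- Expected sign of the score after one more game played with win/draw/loss
probabilities `w, d, l`, starting from score `x`. -/
def stepVal (w d l : ℝ) (x : ℤ) : ℝ := w * sgn (x + 1) + d * sgn x + l * sgn (x - 1)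

/-- Bellman value function with `k` games remaining: `bellman p q k x = V_{N-k}^N(x)`.
With no game remaining the value is the sign of the score; otherwise Player 1 picks the
better of the offensive style `(pw, pd, pl)` and the defensive style `(qw, qd, ql)`. -/
def bellman (pw pd pl qw qd ql : ℝ) : ℕ → ℤ → ℝ
  | 0, x => sgn x
  | k + 1, x =>
      max
        (pw * bellman pw pd pl qw qd ql k (x + 1) + pd * bellman pw pd pl qw qd ql k x +
          pl * bellman pw pd pl qw qd ql k (x - 1))
        (qw * bellman pw pd pl qw qd ql k (x + 1) + qd * bellman pw pd pl qw qd ql k x +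
          ql * bellman pw pd pl qw qd ql k (x - 1))

/-- Optimal gain over `N` games: `g*_N = V_0^N(0)`. -/
def gOpt (pw pd pl qw qd ql : ℝ) (N : ℕ) : ℝ := bellman pw pd pl qw qd ql N 0

/-- The two playing styles of Player 1. -/
inductive Style
  | offense
  | defense
deriving DecidableEq

/-- Selects the probability attached to a style: `a` for offense, `b` for defense. -/
def styleP (a b : ℝ) : Style → ℝ
  | .offense => a
  | .defense => b

/-- Probability mass function of the score process `X_n` under the policy `π`
(playing `π n x` at round `n+1` when the current score is `x`), started at `X_0 = 0`. -/
def polDist (pw pd pl qw qd ql : ℝ) (π : ℕ → ℤ → Style) : ℕ → ℤ → ℝ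
  | 0, x => if x = 0 then 1 else 0
  | n + 1, x =>
      polDist pw pd pl qw qd ql π n (x - 1) * styleP pw qw (π n (x - 1)) +
      polDist pw pd pl qw qd ql π n x * styleP pd qd (π n x) +
      polDist pw pd pl qw qd ql π n (x + 1) * styleP pl ql (π n (x + 1))

/-- Gain of policy `π` over `n` games: `g_n^π = E[sign (X_n)]`. -/
def gPol (pw pd pl qw qd ql : ℝ) (π : ℕ → ℤ → Style) (n : ℕ) : ℝ :=
  ∑' x : ℤ, polDist pw pd pl qw qd ql π n x * sgn x

/-- Probability mass function of the pair (score, switched-to-defense flag) under the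
catenaccio policy: play offense until the score first reaches `+1`, then defense forever. -/
def catDist (pw pd pl qw qd ql : ℝ) : ℕ → ℤ → Bool → ℝ
  | 0, x, b => if x = 0 ∧ b = false then 1 else 0
  | n + 1, x, true =>
      catDist pw pd pl qw qd ql n (x - 1) true * qw +
      catDist pw pd pl qw qd ql n x true * qd +
      catDist pw pd pl qw qd ql n (x + 1) true * ql +
      (if x = 1 then
        catDist pw pd pl qw qd ql n 0 false * pw +
        catDist pw pd pl qw qd ql n 1 false * pd +
        catDist pw pd pl qw qd ql n 2 false * pl
       else 0)
  | n + 1, x, false =>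
      if x = 1 then 0
      else
        catDist pw pd pl qw qd ql n (x - 1) false * pw +
        catDist pw pd pl qw qd ql n x false * pd +
        catDist pw pd pl qw qd ql n (x + 1) false * pl

/-- Gain of the catenaccio policy over `N` games: `g_N^(cat) = E[sign (X_N)]`. -/
def gCat (pw pd pl qw qd ql : ℝ) (N : ℕ) : ℝ :=
  ∑' x : ℤ,
    (catDist pw pd pl qw qd ql N x false + catDist pw pd pl qw qd ql N x true) * sgn x

/-- Gain of the catenaccio+ policy over `N` games: play catenaccio, except that if the
score after `N - 1` games is `0`, the last game is played with the better of the two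
styles (offense if `pw - pl > qw - ql`, defense otherwise). -/
def gCatPlus (pw pd pl qw qd ql : ℝ) : ℕ → ℝ
  | 0 => 0
  | N + 1 =>
      ∑' x : ℤ,
        (catDist pw pd pl qw qd ql N x false *
            (if x = 0 then (if pw - pl > qw - ql then pw - pl else qw - ql)
             else stepVal pw pd pl x) +
          catDist pw pd pl qw qd ql N x true *
            (if x = 0 then (if pw - pl > qw - ql then pw - pl else qw - ql)
             else stepVal qw qd ql x))

/-- Probability mass function of the lazy random walk with i.i.d. increments (+1 with
probability `qw`, 0 with probability `qd`, −1 with probability `ql`), started at `0`. -/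
def walkDist (qw qd ql : ℝ) : ℕ → ℤ → ℝ
  | 0, x => if x = 0 then 1 else 0
  | n + 1, x =>
      walkDist qw qd ql n (x - 1) * qw + walkDist qw qd ql n x * qd +
        walkDist qw qd ql n (x + 1) * ql

/-- Fixed-style gain over `N` games for the walk with step law `(qw, qd, ql)`. -/
def gFixed (qw qd ql : ℝ) (N : ℕ) : ℝ := ∑' x : ℤ, walkDist qw qd ql N x * sgn x

/-- Probability mass function of the lazy random walk with step law `(pw, pd, pl)`,
started at `0` and absorbed (stopped) at the level `+1`.  In particular
`stoppedDist pw pd pl n 1` is the probability that the walk reaches `+1` by time `n`. -/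
def stoppedDist (pw pd pl : ℝ) : ℕ → ℤ → ℝ
  | 0, x => if x = 0 then 1 else 0
  | n + 1, x =>
      if x = 1 then
        stoppedDist pw pd pl n 1 + stoppedDist pw pd pl n 0 * pw +
          stoppedDist pw pd pl n 2 * pl
      else
        (if x - 1 = 1 then 0 else stoppedDist pw pd pl n (x - 1) * pw) +
          stoppedDist pw pd pl n x * pd +
          (if x + 1 = 1 then 0 else stoppedDist pw pd pl n (x + 1) * pl)

/-- Expectation of `f` after one step, from `x`, of the symmetric lazy random walk on `ℤ`
with holding probability `d` and probability `q` of each of the moves `±1`. -/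
def walkAvg (q d : ℝ) (f : ℤ → ℝ) (x : ℤ) : ℝ := q * f (x + 1) + d * f x + q * f (x - 1)

/-- `f` is monotone and its consecutive increments have ratios in `[r⁻¹, r]`. -/
def IncrRatioBounded (r : ℝ) (f : ℤ → ℝ) : Prop :=
  ∀ x, f (x + 1) - f x ≤ r * (f x - f (x - 1)) ∧ f x - f (x - 1) ≤ r * (f (x + 1) - f x) ∧
    0 ≤ f (x + 1) - f x

theorem IncrRatioBounded.avg {q d r : ℝ} {f : ℤ → ℝ} (hf : IncrRatioBounded r f)
    (hq : 0 ≤ q) (hd : 0 ≤ d) : IncrRatioBounded r (walkAvg q d f) := by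
  intro x
  obtain ⟨a1, a2, a3⟩ := hf x
  obtain ⟨b1, b2, b3⟩ := hf (x + 1)
  obtain ⟨c1, c2, c3⟩ := hf (x - 1)
  simp only [walkAvg, add_sub_cancel_right, sub_add_cancel] at *
  refine ⟨?_, ?_, ?_⟩
  · linarith [mul_le_mul_of_nonneg_left a1 hd, mul_le_mul_of_nonneg_left b1 hq,
      mul_le_mul_of_nonneg_left c1 hq]
  · linarith [mul_le_mul_of_nonneg_left a2 hd, mul_le_mul_of_nonneg_left b2 hq,
      mul_le_mul_of_nonneg_left c2 hq]
  · linarith [mul_nonneg hd a3, mul_nonneg hq b3, mul_nonneg hq c3]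

theorem IncrRatioBounded.iterate_avg {q d r : ℝ} {f : ℤ → ℝ} (hf : IncrRatioBounded r f)
    (hq : 0 ≤ q) (hd : 0 ≤ d) (n : ℕ) : IncrRatioBounded r ((walkAvg q d)^[n] f) := by
  induction n with
  | zero => exact hf
  | succ n ih =>
    rw [Function.iterate_succ_apply']
    exact ih.avg hq hd

/-- A style with negative drift `pw - pl` is no better than a fair style for a function whose
increments vary slowly compared with the drift. -/
theorem IncrRatioBounded.step_le {pw pd pl q d : ℝ} {f : ℤ → ℝ}
    (hf : IncrRatioBounded (1 + (pl - pw)) f) (hpw : 0 ≤ pw) (hpd : 0 ≤ pd)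
    (hp : pw + pd + pl = 1) (hq : 0 ≤ q) (hd : 0 ≤ d) (hqd : q + d + q = 1)
    (hlt : pw < pl) (x : ℤ) :
    pw * f (x + 1) + pd * f x + pl * f (x - 1) ≤ walkAvg q d f x := by
  obtain ⟨h1, h2, h3⟩ := hf x
  have h4 := (hf (x - 1)).2.2
  rw [sub_add_cancel] at h4
  obtain rfl : pd = 1 - pw - pl := by linarith
  obtain rfl : d = 1 - q - q := by linarith
  unfold walkAvg
  generalize ha : f (x + 1) - f x = a at *
  generalize hb : f x - f (x - 1) = b at *
  suffices h : (pw - q) * (a - b) ≤ (pl - pw) * b by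
    rw [← ha, ← hb] at h
    linarith
  have hδ : 0 ≤ pl - pw := by linarith
  have hab : |a - b| ≤ (pl - pw) * b := by
    rw [abs_le]
    refine ⟨?_, by linarith⟩
    rcases le_total b a with hba | hba
    · linarith [mul_nonneg hδ h4]
    · linarith [mul_le_mul_of_nonneg_left hba hδ]
  calc (pw - q) * (a - b) ≤ |(pw - q) * (a - b)| := le_abs_self _
    _ = |pw - q| * |a - b| := abs_mul _ _
    _ ≤ 1 * |a - b| := by
        gcongr
        rw [abs_le]
        constructor <;> linarith
    _ ≤ (pl - pw) * b := by rwa [one_mul]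

/-- An increasing function on `ℤ`, antisymmetric about `-1/2`, with increments
`2 * (1 - s) * s ^ |x|` and limits `±(1 + s)` at infinity. -/
def laplaceStep (s : ℝ) : ℤ → ℝ
  | .ofNat n => 1 + s - 2 * s ^ (n + 1)
  | .negSucc n => -(1 + s) + 2 * s ^ (n + 1)

theorem laplaceStep_sub (s : ℝ) (x : ℤ) :
    laplaceStep s x - laplaceStep s (x - 1) = 2 * (1 - s) * s ^ x.natAbs := by
  rcases x with (_ | n) | n
  · change (1 + s - 2 * s ^ (0 + 1)) - (-(1 + s) + 2 * s ^ (0 + 1)) = 2 * (1 - s) * s ^ 0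
    ring
  · have h : Int.ofNat (n + 1) - 1 = Int.ofNat n := by simp
    rw [h]
    change (1 + s - 2 * s ^ (n + 1 + 1)) - (1 + s - 2 * s ^ (n + 1)) = 2 * (1 - s) * s ^ (n + 1)
    ring
  · have h : Int.negSucc n - 1 = Int.negSucc (n + 1) := rfl
    rw [h]
    change (-(1 + s) + 2 * s ^ (n + 1)) - (-(1 + s) + 2 * s ^ (n + 1 + 1)) =
      2 * (1 - s) * s ^ (n + 1)
    ring

theorem laplaceStep_neg (s : ℝ) (x : ℤ) : laplaceStep s (-1 - x) = -laplaceStep s x := by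
  rcases x with n | n
  · have h : -1 - Int.ofNat n = Int.negSucc n := by grind
    rw [h]
    simp only [laplaceStep]
    ring
  · have h : -1 - Int.negSucc n = Int.ofNat n := by grind
    rw [h]
    simp only [laplaceStep]
    ring

theorem laplaceStep_incrRatioBounded {s r : ℝ} (hs : 0 ≤ s) (hs1 : s ≤ 1) (hrs : r * s = 1)
    (hr : 1 ≤ r) : IncrRatioBounded r (laplaceStep s) := by
  intro x
  have h1 := laplaceStep_sub s (x + 1)
  rw [add_sub_cancel_right] at h1
  rw [h1, laplaceStep_sub s x]
  have hc : 0 ≤ 2 * (1 - s) := by linarith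
  have key : ∀ m n : ℕ, n ≤ m + 1 → 2 * (1 - s) * s ^ m ≤ r * (2 * (1 - s) * s ^ n) := by
    intro m n hmn
    calc 2 * (1 - s) * s ^ m = r * (2 * (1 - s) * s ^ (m + 1)) := by
          linear_combination (-(2 * (1 - s) * s ^ m)) * hrs
      _ ≤ r * (2 * (1 - s) * s ^ n) := by
          have := pow_le_pow_of_le_one hs hs1 hmn
          gcongr
  exact ⟨key _ _ (by omega), key _ _ (by omega), by positivity⟩

theorem sgn_le_laplaceStep {s : ℝ} (hs : 0 ≤ s) (hs1 : s ≤ 1) (L : ℕ) (x : ℤ) :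
    (1 + s) * sgn x ≤ laplaceStep s (x + L) + 2 * s ^ (L + 1) := by
  have hL : 0 ≤ s ^ (L + 1) := by positivity
  rcases lt_or_ge x 0 with hx | hx
  · have h : sgn x = -1 := by simp [sgn, hx, hx.le]
    rw [h]
    rcases x + (L : ℤ) with n | n <;> simp only [laplaceStep]
    · have : s ^ (n + 1) ≤ 1 := pow_le_one₀ hs hs1
      linarith
    · have : 0 ≤ s ^ (n + 1) := by positivity
      linarith
  · have h : sgn x ≤ 1 := by
      unfold sgn
      split_ifs <;> norm_num
    lift x to ℕ using hx
    have h2 : s ^ (x + L + 1) ≤ s ^ (L + 1) := pow_le_pow_of_le_one hs hs1 (by omega)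
    have h3 : laplaceStep s ((x : ℤ) + L) = 1 + s - 2 * s ^ (x + L + 1) := rfl
    rw [h3]
    nlinarith

/-- Fourier integral giving `2π` times the `n`-step transition probability. -/
def walkFourier (q d : ℝ) (n : ℕ) (x : ℤ) : ℝ :=
  ∫ θ in (-Real.pi)..Real.pi, (d + 2 * q * Real.cos θ) ^ n * Real.cos (x * θ)

theorem walkFourier_zero (q d : ℝ) (x : ℤ) :
    walkFourier q d 0 x = if x = 0 then 2 * Real.pi else 0 := by
  unfold walkFourier
  split_ifs with h
  · simp [h]
    ring
  · have hx : (x : ℝ) ≠ 0 := by exact_mod_cast h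
    simp [intervalIntegral.integral_comp_mul_left (fun t => Real.cos t) hx]

theorem walkFourier_succ (q d : ℝ) (n : ℕ) :
    walkFourier q d (n + 1) = walkAvg q d (walkFourier q d n) := by
  ext x
  unfold walkAvg walkFourier
  rw [← intervalIntegral.integral_const_mul, ← intervalIntegral.integral_const_mul,
    ← intervalIntegral.integral_const_mul, ← intervalIntegral.integral_add,
    ← intervalIntegral.integral_add]
  · congr 1
    ext θ
    push_cast
    rw [add_mul, sub_mul, one_mul, Real.cos_add, Real.cos_sub]
    ring
  all_goals exact Continuous.intervalIntegrable (by fun_prop) _ _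

theorem tendsto_walkFourier {q d : ℝ} (hq : 0 < q) (hd : 0 ≤ d) (hqd : q + d + q = 1) (x : ℤ) :
    Tendsto (fun n => walkFourier q d n x) atTop (𝓝 0) := by
  have hzero : (∫ _ in (-Real.pi)..Real.pi, (0 : ℝ)) = 0 := by simp
  rw [← hzero]
  have hle : ∀ θ : ℝ, |d + 2 * q * Real.cos θ| ≤ 1 := by
    intro θ
    rw [abs_le]
    constructor <;> nlinarith [Real.neg_one_le_cos θ, Real.cos_le_one θ]
  refine intervalIntegral.tendsto_integral_filter_of_dominated_convergence (fun _ => (1 : ℝ))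
    ?_ ?_ ?_ ?_
  · exact Eventually.of_forall fun n => Continuous.aestronglyMeasurable (by fun_prop)
  · refine Eventually.of_forall fun n => Eventually.of_forall fun θ _ => ?_
    rw [Real.norm_eq_abs, abs_mul, abs_pow]
    exact mul_le_one₀ (pow_le_one₀ (abs_nonneg _) (hle θ)) (abs_nonneg _) (Real.abs_cos_le_one _)
  · exact intervalIntegrable_const
  · have hne : ∀ a : ℝ, ∀ᵐ θ : ℝ, θ ≠ a := fun a => MeasureTheory.Measure.ae_ne _ a
    filter_upwards [hne 0, hne Real.pi] with θ h0 hpi hθ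
    rw [Set.uIoc_of_le (by linarith [Real.pi_pos])] at hθ
    have hlt : |d + 2 * q * Real.cos θ| < 1 := by
      have hlt' : Real.cos θ < 1 := (Real.cos_le_one θ).lt_of_ne fun h =>
        h0 ((Real.cos_eq_one_iff_of_lt_of_lt (by linarith [hθ.1, Real.pi_pos])
          (by linarith [hθ.2, Real.pi_pos])).1 h)
      have hgt : -1 < Real.cos θ := by
        rw [← Real.cos_abs, ← Real.cos_pi]
        exact Real.cos_lt_cos_of_nonneg_of_le_pi (abs_nonneg θ) le_rfl
          (abs_lt.2 ⟨hθ.1, hθ.2.lt_of_ne hpi⟩)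
      rw [abs_lt]
      constructor <;> nlinarith
    simpa using (tendsto_pow_atTop_nhds_zero_of_abs_lt_one hlt).mul_const (Real.cos (x * θ))

theorem walkAvg_mono {q d : ℝ} (hq : 0 ≤ q) (hd : 0 ≤ d) : Monotone (walkAvg q d) := by
  intro f g h x
  unfold walkAvg
  have h1 := h (x + 1)
  have h2 := h x
  have h3 := h (x - 1)
  gcongr

theorem iterate_walkAvg_pow_le {q d s : ℝ} (hq : 0 ≤ q) (hd : 0 ≤ d) (hqd : q + d + q = 1)
    (hs : 0 ≤ s) (hs1 : s ≤ 1) (M n : ℕ) (x : ℤ) :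
    (walkAvg q d)^[n] (fun y => s ^ y.natAbs) x ≤
      s ^ M + ∑ y ∈ Icc (-M : ℤ) M, walkFourier q d n (x - y) / (2 * Real.pi) := by
  induction n generalizing x with
  | zero =>
    simp only [Function.iterate_zero, id, walkFourier_zero, sub_eq_zero, ite_div, zero_div,
      Finset.sum_ite_eq, Finset.mem_Icc]
    rw [div_self (by positivity)]
    split_ifs with h
    · have : s ^ x.natAbs ≤ 1 := pow_le_one₀ hs hs1
      have : 0 ≤ s ^ M := by positivity
      linarith
    · rw [add_zero]
      exact pow_le_pow_of_le_one hs hs1 (by omega)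
  | succ n ih =>
    rw [Function.iterate_succ_apply', walkFourier_succ]
    refine (walkAvg_mono hq hd ih x).trans (le_of_eq ?_)
    unfold walkAvg
    rw [mul_add, mul_add, mul_add, Finset.mul_sum, Finset.mul_sum, Finset.mul_sum]
    have h : ∀ a b c : ℝ, q * s ^ M + a + (d * s ^ M + b) + (q * s ^ M + c) =
        s ^ M + (a + b + c) := fun a b c => by linear_combination s ^ M * hqd
    rw [h, ← Finset.sum_add_distrib, ← Finset.sum_add_distrib]
    congr 1
    refine Finset.sum_congr rfl fun y _ => ?_
    rw [add_sub_right_comm, sub_right_comm]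
    ring

theorem tendsto_iterate_walkAvg_pow {q d s : ℝ} (hq : 0 < q) (hd : 0 ≤ d) (hqd : q + d + q = 1)
    (hs : 0 ≤ s) (hs1 : s < 1) (x : ℤ) :
    Tendsto (fun n => (walkAvg q d)^[n] (fun y => s ^ y.natAbs) x) atTop (𝓝 0) := by
  have hnonneg : ∀ n, 0 ≤ (walkAvg q d)^[n] (fun y => s ^ y.natAbs) := by
    intro n
    induction n with
    | zero => exact fun y => pow_nonneg hs _
    | succ n ih =>
      rw [Function.iterate_succ_apply']
      refine le_trans (fun y => ?_) (walkAvg_mono hq.le hd ih)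
      simp [walkAvg]
  refine tendsto_order.2 ⟨fun a ha => Eventually.of_forall fun n => ha.trans_le (hnonneg n x),
    fun ε hε => ?_⟩
  obtain ⟨M, hM⟩ := exists_pow_lt_of_lt_one hε hs1
  have hlim : Tendsto (fun n => s ^ M + ∑ y ∈ Icc (-M : ℤ) M,
      walkFourier q d n (x - y) / (2 * Real.pi)) atTop (𝓝 (s ^ M)) := by
    have := tendsto_finsetSum (Icc (-M : ℤ) M) fun y _ =>
      (tendsto_walkFourier hq hd hqd (x - y)).div_const (2 * Real.pi)
    simpa using this.const_add (s ^ M)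
  filter_upwards [hlim.eventually_lt_const hM] with n hn
  exact (iterate_walkAvg_pow_le hq.le hd hqd hs hs1.le M n x).trans_lt hn

theorem iterate_walkAvg_laplaceStep_sub (q d s : ℝ) (n : ℕ) (x : ℤ) :
    (walkAvg q d)^[n] (laplaceStep s) x - (walkAvg q d)^[n] (laplaceStep s) (x - 1) =
      2 * (1 - s) * (walkAvg q d)^[n] (fun y => s ^ y.natAbs) x := by
  induction n generalizing x with
  | zero => exact laplaceStep_sub s x
  | succ n ih =>
    have h1 := ih (x + 1)
    have h3 := ih (x - 1)
    rw [add_sub_cancel_right] at h1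
    simp only [Function.iterate_succ_apply']
    rw [walkAvg, walkAvg, walkAvg, sub_add_cancel]
    linear_combination q * h1 + d * ih x + q * h3

theorem iterate_walkAvg_laplaceStep_neg (q d s : ℝ) (n : ℕ) (x : ℤ) :
    (walkAvg q d)^[n] (laplaceStep s) (-1 - x) = -(walkAvg q d)^[n] (laplaceStep s) x := by
  induction n generalizing x with
  | zero => exact laplaceStep_neg s x
  | succ n ih =>
    simp only [Function.iterate_succ_apply']
    rw [walkAvg, walkAvg, show -1 - x + 1 = -1 - (x - 1) by ring,
      show -1 - x - 1 = -1 - (x + 1) by ring, ih, ih, ih]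
    ring

theorem tendsto_iterate_walkAvg_laplaceStep {q d s : ℝ} (hq : 0 < q) (hd : 0 ≤ d)
    (hqd : q + d + q = 1) (hs : 0 ≤ s) (hs1 : s < 1) (L : ℕ) :
    Tendsto (fun n => (walkAvg q d)^[n] (laplaceStep s) L) atTop (𝓝 0) := by
  induction L with
  | zero =>
    have h := (tendsto_iterate_walkAvg_pow hq hd hqd hs hs1 0).const_mul (1 - s)
    rw [mul_zero] at h
    refine h.congr fun n => ?_
    have h1 := iterate_walkAvg_laplaceStep_sub q d s n 0
    have h2 := iterate_walkAvg_laplaceStep_neg q d s n 0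
    rw [zero_sub] at h1
    rw [sub_zero] at h2
    push_cast
    linarith
  | succ L ih =>
    have h := (tendsto_iterate_walkAvg_pow hq hd hqd hs hs1 (L + 1)).const_mul (2 * (1 - s))
    have h2 := ih.add h
    rw [mul_zero, add_zero] at h2
    refine h2.congr fun n => ?_
    have h1 := iterate_walkAvg_laplaceStep_sub q d s n (L + 1)
    rw [add_sub_cancel_right] at h1
    push_cast
    linarith

section Policy

variable {pw pd pl qw qd ql : ℝ} {π : ℕ → ℤ → Style}

theorem polDist_eq_zero (n : ℕ) (x : ℤ) (hx : n < x.natAbs) :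
    polDist pw pd pl qw qd ql π n x = 0 := by
  induction n generalizing x with
  | zero => simp only [polDist, if_neg (show x ≠ 0 by omega)]
  | succ n ih =>
    rw [polDist, ih _ (by omega), ih _ (by omega), ih _ (by omega)]
    simp

theorem polDist_nonneg (hpw : 0 ≤ pw) (hpd : 0 ≤ pd) (hpl : 0 ≤ pl) (hqw : 0 ≤ qw)
    (hqd : 0 ≤ qd) (hql : 0 ≤ ql) (n : ℕ) (x : ℤ) : 0 ≤ polDist pw pd pl qw qd ql π n x := by
  have hst : ∀ {a b : ℝ} (s : Style), 0 ≤ a → 0 ≤ b → 0 ≤ styleP a b s := by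
    intro a b s ha hb
    cases s <;> assumption
  induction n generalizing x with
  | zero =>
    unfold polDist
    split_ifs <;> norm_num
  | succ n ih =>
    rw [polDist]
    have h1 := ih (x - 1)
    have h2 := ih x
    have h3 := ih (x + 1)
    have := hst (π n (x - 1)) hpw hqw
    have := hst (π n x) hpd hqd
    have := hst (π n (x + 1)) hpl hql
    positivity

theorem summable_polDist_mul (n : ℕ) (f : ℤ → ℝ) :
    Summable fun x => polDist pw pd pl qw qd ql π n x * f x := by
  refine summable_of_ne_finset_zero (s := Icc (-n : ℤ) n) fun x hx => ?_
  rw [polDist_eq_zero n x (by rw [Finset.mem_Icc] at hx; omega), zero_mul]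

theorem tsum_polDist_zero (f : ℤ → ℝ) :
    ∑' x, polDist pw pd pl qw qd ql π 0 x * f x = f 0 := by
  rw [tsum_eq_single 0 fun x hx => by simp [polDist, hx]]
  simp [polDist]

theorem tsum_polDist_succ (n : ℕ) (f : ℤ → ℝ) :
    ∑' x, polDist pw pd pl qw qd ql π (n + 1) x * f x =
      ∑' x, polDist pw pd pl qw qd ql π n x * (styleP pw qw (π n x) * f (x + 1) +
        styleP pd qd (π n x) * f x + styleP pl ql (π n x) * f (x - 1)) := by
  have h1 := (Equiv.subRight (1 : ℤ)).hasSum_iff.2 (summable_polDist_mul (pw := pw) (pd := pd)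
    (pl := pl) (qw := qw) (qd := qd) (ql := ql) (π := π) n
    fun x => styleP pw qw (π n x) * f (x + 1)).hasSum
  have h2 := (summable_polDist_mul (pw := pw) (pd := pd)
    (pl := pl) (qw := qw) (qd := qd) (ql := ql) (π := π) n
    fun x => styleP pd qd (π n x) * f x)
  have h3 := (Equiv.addRight (1 : ℤ)).hasSum_iff.2 (summable_polDist_mul (pw := pw) (pd := pd)
    (pl := pl) (qw := qw) (qd := qd) (ql := ql) (π := π) n
    fun x => styleP pl ql (π n x) * f (x - 1)).hasSum
  simp only [mul_add]
  rw [((summable_polDist_mul n _).add (summable_polDist_mul n _)).tsum_add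
    (summable_polDist_mul n _), (summable_polDist_mul n _).tsum_add (summable_polDist_mul n _),
    ← ((h1.add h2.hasSum).add h3).tsum_eq]
  refine tsum_congr fun x => ?_
  simp only [Function.comp, Equiv.subRight_apply, Equiv.coe_addRight, sub_add_cancel,
    add_sub_cancel_right, polDist]
  ring

theorem tsum_polDist_const (hp : pw + pd + pl = 1) (hq : qw + qd + ql = 1) (c : ℝ) (n : ℕ) :
    ∑' x, polDist pw pd pl qw qd ql π n x * c = c := by
  induction n with
  | zero => exact tsum_polDist_zero fun _ => c
  | succ n ih =>
    rw [tsum_polDist_succ n fun _ => c, ← ih]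
    refine tsum_congr fun x => ?_
    rw [ih, ← add_mul, ← add_mul]
    cases π n x <;> simp [styleP, hp, hq]

end Policy

theorem tsum_polDist_mul_le {pw pd pl q qd : ℝ} {π : ℕ → ℤ → Style} {f : ℤ → ℝ}
    (hf : IncrRatioBounded (1 + (pl - pw)) f) (hpw : 0 ≤ pw) (hpd : 0 ≤ pd) (hpl : 0 ≤ pl)
    (hp : pw + pd + pl = 1) (hq : 0 ≤ q) (hqd : 0 ≤ qd) (hqq : q + qd + q = 1) (hlt : pw < pl)
    (n k : ℕ) :
    ∑' x, polDist pw pd pl q qd q π n x * (walkAvg q qd)^[k] f x ≤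
      (walkAvg q qd)^[n + k] f 0 := by
  induction n generalizing k with
  | zero => rw [tsum_polDist_zero, zero_add]
  | succ n ih =>
    rw [tsum_polDist_succ, add_right_comm, add_assoc]
    refine le_trans ?_ (ih (k + 1))
    refine (summable_polDist_mul n _).tsum_le_tsum (fun x => ?_) (summable_polDist_mul n _)
    refine mul_le_mul_of_nonneg_left ?_ (polDist_nonneg hpw hpd hpl hq hqd hq n x)
    rw [Function.iterate_succ_apply']
    cases π n x
    · exact (hf.iterate_avg hq hqd k).step_le hpw hpd hp hq hqd hqq hlt x
    · exact le_rfl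

theorem iterate_walkAvg_comp_add (q d : ℝ) (f : ℤ → ℝ) (L : ℤ) (n : ℕ) (x : ℤ) :
    (walkAvg q d)^[n] (fun y => f (y + L)) x = (walkAvg q d)^[n] f (x + L) := by
  induction n generalizing x with
  | zero => rfl
  | succ n ih =>
    simp only [Function.iterate_succ_apply', walkAvg, ih, add_right_comm, add_sub_right_comm]

theorem IncrRatioBounded.comp_add {r : ℝ} {f : ℤ → ℝ} (hf : IncrRatioBounded r f) (L : ℤ) :
    IncrRatioBounded r fun y => f (y + L) := by
  intro x
  have h := hf (x + L)
  rwa [add_right_comm, add_sub_right_comm] at h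

/-- If `qw = ql > 0` and `pw < pl`, then for every policy `π` the gain
over `n` games satisfies `limsup_{n → ∞} g_n^π ≤ 0`. -/
theorem limsup_gain_nonpos_of_fair_nonsafe
    (pw pd pl qw qd ql : ℝ)
    (hpw : 0 ≤ pw) (hpd : 0 ≤ pd) (hpl : 0 ≤ pl) (hp : pw + pd + pl = 1)
    (hqw : 0 ≤ qw) (hqd : 0 ≤ qd) (hql : 0 ≤ ql) (hq : qw + qd + ql = 1)
    (hfair : qw = ql) (hq0 : 0 < ql) (hlosep : pw < pl) :
    ∀ π : ℕ → ℤ → Style,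
      Filter.limsup (fun n : ℕ => gPol pw pd pl qw qd ql π n) atTop ≤ 0 := by
  subst hfair
  intro π
  have hδ : 0 < pl - pw := by linarith
  set s : ℝ := (1 + (pl - pw))⁻¹ with hs_def
  have hs : 0 < s := by positivity
  have hs1 : s < 1 := inv_lt_one_of_one_lt₀ (by linarith)
  have hrs : (1 + (pl - pw)) * s = 1 := mul_inv_cancel₀ (by positivity)
  have hratio := laplaceStep_incrRatioBounded hs.le hs1.le hrs (by linarith)
  have hbound : ∀ L n : ℕ, (1 + s) * gPol pw pd pl qw qd qw π n ≤
      (walkAvg qw qd)^[n] (laplaceStep s) L + 2 * s ^ (L + 1) := by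
    intro L n
    have h := tsum_polDist_mul_le (π := π) (hratio.comp_add L) hpw hpd hpl hp hqw hqd hq hlosep n 0
    rw [add_zero, iterate_walkAvg_comp_add, zero_add] at h
    rw [gPol, ← tsum_mul_left]
    refine le_trans ?_ (add_le_add h (tsum_polDist_const (π := π) hp hq (2 * s ^ (L + 1)) n).le)
    rw [← (summable_polDist_mul n _).tsum_add (summable_polDist_mul n _)]
    refine ((summable_polDist_mul n _).mul_left _).tsum_le_tsum (fun x => ?_)
      ((summable_polDist_mul n _).add (summable_polDist_mul n _))
    rw [← mul_add, mul_left_comm]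
    exact mul_le_mul_of_nonneg_left (sgn_le_laplaceStep hs.le hs1.le L x)
      (polDist_nonneg hpw hpd hpl hqw hqd hqw n x)
  have hlower : ∀ n, -1 ≤ gPol pw pd pl qw qd qw π n := by
    intro n
    rw [← tsum_polDist_const (π := π) hp hq (-1) n, gPol]
    refine (summable_polDist_mul n _).tsum_le_tsum (fun x => ?_) (summable_polDist_mul n _)
    refine mul_le_mul_of_nonneg_left ?_ (polDist_nonneg hpw hpd hpl hqw hqd hqw n x)
    unfold sgn
    split_ifs <;> norm_num
  refine le_of_forall_pos_le_add fun ε hε => ?_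
  rw [zero_add]
  refine limsup_le_of_le
    (isCoboundedUnder_le_of_le atTop hlower) ?_
  obtain ⟨L, hL⟩ := exists_pow_lt_of_lt_one (show 0 < ε / 2 by positivity) hs1
  have hlim := (tendsto_iterate_walkAvg_laplaceStep hq0 hqd hq hs.le hs1 L).add_const
    (2 * s ^ (L + 1))
  have hlt : 0 + 2 * s ^ (L + 1) < ε := by
    rw [pow_succ]
    nlinarith [pow_pos hs L]
  filter_upwards [hlim.eventually_lt_const hlt] with n hn
  have h := (hbound L n).trans_lt hn
  rcases le_total (gPol pw pd pl qw qd qw π n) 0 with h0 | h0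
  · linarith
  · nlinarith
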